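/- Let M be a spacelike surface in ℝ^{3,1} with a canonical normal null direction Z. Then A_{Z^⊥}(Z^⊤) = 0 and ∇_{Z^⊤} Z^⊤ = 0; in particular, ⟨B(X, Z^⊤), Z^⊥⟩ = 0 for every tangent vector field X on M. -/

import Mathlib

noncomputable section

/-- Points of the parameter domain of the surface chart. -/
abbrev Pt : Type := ℝ × ℝ

/-- Vectors of the Minkowski space `ℝ^{3,1}`. -/
abbrev E4 : Type := Fin 4 → ℝ

/-- The Minkowski bilinear form of signature `(+,+,+,-)` on `ℝ⁴`. -/
def mink (v w : E4) : ℝ := v 0 * w 0 + v 1 * w 1 + v 2 * w 2 - v 3 * w 3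

/-- Realization in `ℝ^{3,1}` of a coordinate vector field `X` along the immersion `ψ`. -/
def vecF (ψ : Pt → E4) (X : Pt → Pt) : Pt → E4 := fun p => fderiv ℝ ψ p (X p)

/-- Flat (ambient) derivative of an `ℝ⁴`-valued field along a coordinate vector field. -/
def Dflat (X : Pt → Pt) (V : Pt → E4) : Pt → E4 := fun p => fderiv ℝ V p (X p)

/-- Second fundamental form `B(X,Y) = ∇̄_X Y − ∇_X Y`. -/
def sff (ψ : Pt → E4) (conn : (Pt → Pt) → (Pt → Pt) → Pt → Pt) (X Y : Pt → Pt) : Pt → E4 :=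
  fun p => Dflat X (vecF ψ Y) p - vecF ψ (conn X Y) p

/-- `v` is tangent to the surface at `p`. -/
def isTangentV (ψ : Pt → E4) (p : Pt) (v : E4) : Prop := ∃ w : Pt, fderiv ℝ ψ p w = v

/-- `v` is normal to the surface at `p`. -/
def isNormalV (ψ : Pt → E4) (p : Pt) (v : E4) : Prop := ∀ w : Pt, mink v (fderiv ℝ ψ p w) = 0

/-- Lie bracket of coordinate vector fields on the chart. -/
def lieB (X Y : Pt → Pt) : Pt → Pt := fun p => fderiv ℝ Y p (X p) - fderiv ℝ X p (Y p)

/-- Curvature tensor `R(X,Y)V = ∇_Y∇_X V − ∇_X∇_Y V + ∇_{[X,Y]}V`. -/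
def curvR (conn : (Pt → Pt) → (Pt → Pt) → Pt → Pt) (X Y V : Pt → Pt) : Pt → Pt :=
  fun p => conn Y (conn X V) p - conn X (conn Y V) p + conn (lieB X Y) V p

/-- Normal curvature tensor `R^⊥(X,Y)ν = ∇⊥_Y∇⊥_X ν − ∇⊥_X∇⊥_Y ν + ∇⊥_{[X,Y]}ν`. -/
def curvRperp (nconn : (Pt → Pt) → (Pt → E4) → Pt → E4) (X Y : Pt → Pt) (ν : Pt → E4) :
    Pt → E4 :=
  fun p => nconn Y (nconn X ν) p - nconn X (nconn Y ν) p + nconn (lieB X Y) ν p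

/-- Determinant of four vectors of `ℝ⁴` (the volume form `e₁∧e₂∧e₃∧e₄ ↦ 1`). -/
def det4 (a b c d : E4) : ℝ := Matrix.det (Matrix.of ![a, b, c, d])

/-- A spacelike surface in `ℝ^{3,1}`, given by a chart `ψ : U → ℝ^{3,1}`, endowed with a
canonical normal null direction with respect to the constant unit spacelike vector `Z`,
together with all the associated geometric data: the Levi-Civita connection `conn`,
the normal connection `nconn`, the tangent part `Z^⊤` (coordinates `ZT`), the oriented
orthonormal completion `W` (coordinates `Wc`), the shape operator `shA = A_{Z^⊥}`,
the 1-form `β` with `B(X,Z^⊤) = β(X)Z^⊥`, and the lightlike normal field `W'` with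
`⟨Z^⊥,W'⟩ = 1`.  Each piece of data is characterized by its defining property. -/
structure CNND where
  U : Set Pt
  hUopen : IsOpen U
  ψ : Pt → E4
  hψ : ContDiffOn ℝ (⊤ : ℕ∞) ψ U
  himm : ∀ p ∈ U, ∀ v : Pt, fderiv ℝ ψ p v = 0 → v = 0
  hspacelike : ∀ p ∈ U, ∀ v : Pt, v ≠ 0 → 0 < mink (fderiv ℝ ψ p v) (fderiv ℝ ψ p v)
  /-- Levi-Civita connection of the induced metric, as the tangent part of the flat one. -/
  conn : (Pt → Pt) → (Pt → Pt) → Pt → Pt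
  hconn : ∀ X Y, ∀ p ∈ U, DifferentiableAt ℝ (vecF ψ Y) p → isNormalV ψ p (sff ψ conn X Y p)
  hconnSmooth : ∀ X Y, ContDiffOn ℝ (⊤ : ℕ∞) X U → ContDiffOn ℝ (⊤ : ℕ∞) Y U → ContDiffOn ℝ (⊤ : ℕ∞) (conn X Y) U
  /-- Normal connection: the normal part of the flat derivative of a normal field. -/
  nconn : (Pt → Pt) → (Pt → E4) → Pt → E4
  hnconn : ∀ X ν, ∀ p ∈ U, (∀ q ∈ U, isNormalV ψ q (ν q)) → DifferentiableAt ℝ ν p →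
    isNormalV ψ p (nconn X ν p) ∧ isTangentV ψ p (Dflat X ν p - nconn X ν p)
  hnconnSmooth : ∀ X ν, ContDiffOn ℝ (⊤ : ℕ∞) X U → (∀ q ∈ U, isNormalV ψ q (ν q)) →
    ContDiffOn ℝ (⊤ : ℕ∞) ν U → ContDiffOn ℝ (⊤ : ℕ∞) (nconn X ν) U
  /-- The parallel (constant) vector field `Z`, a unit spacelike vector. -/
  Z : E4
  hZunit : mink Z Z = 1
  /-- Coordinates of the tangent part `Z^⊤` of `Z`; `Z^⊥ = Z − Z^⊤` is normal. -/
  ZT : Pt → Pt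
  hZTsmooth : ContDiffOn ℝ (⊤ : ℕ∞) ZT U
  hZTtangentpart : ∀ p ∈ U, isNormalV ψ p (Z - fderiv ℝ ψ p (ZT p))
  /-- canonical normal null direction: `Z^⊥` is lightlike … -/
  hZperpNull : ∀ p ∈ U, mink (Z - fderiv ℝ ψ p (ZT p)) (Z - fderiv ℝ ψ p (ZT p)) = 0
  /-- … and nowhere zero. -/
  hZperpNe : ∀ p ∈ U, Z - fderiv ℝ ψ p (ZT p) ≠ 0
  /-- Coordinates of the unit tangent field `W` orthogonal to `Z^⊤`, positively oriented. -/
  Wc : Pt → Pt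
  hWsmooth : ContDiffOn ℝ (⊤ : ℕ∞) Wc U
  hWunit : ∀ p ∈ U, mink (fderiv ℝ ψ p (Wc p)) (fderiv ℝ ψ p (Wc p)) = 1
  hWorth : ∀ p ∈ U, mink (fderiv ℝ ψ p (ZT p)) (fderiv ℝ ψ p (Wc p)) = 0
  hWorient : ∀ p ∈ U, 0 < (ZT p).1 * (Wc p).2 - (ZT p).2 * (Wc p).1
  /-- The shape operator `A_{Z^⊥}`: `⟨A_{Z^⊥}X, Y⟩ = ⟨B(X,Y), Z^⊥⟩`. -/
  shA : (Pt → Pt) → Pt → Pt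
  hshA : ∀ X Y, ∀ p ∈ U, DifferentiableAt ℝ (vecF ψ Y) p →
    mink (fderiv ℝ ψ p (shA X p)) (fderiv ℝ ψ p (Y p)) =
      mink (sff ψ conn X Y p) (Z - fderiv ℝ ψ p (ZT p))
  /-- The 1-form `β` with `B(X, Z^⊤) = β(X) Z^⊥`. -/
  beta : Pt → Pt → ℝ
  hbeta : ∀ X, ∀ p ∈ U, sff ψ conn X ZT p = beta p (X p) • (Z - fderiv ℝ ψ p (ZT p))
  /-- The lightlike normal field `W'` with `⟨Z^⊥, W'⟩ = 1`, such that
  `(Z^⊤, W, (Z^⊥+W')/√2, (Z^⊥−W')/√2)` is a positively oriented orthonormal frame. -/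
  Wp : Pt → E4
  hWpNormal : ∀ p ∈ U, isNormalV ψ p (Wp p)
  hWpNull : ∀ p ∈ U, mink (Wp p) (Wp p) = 0
  hWpPair : ∀ p ∈ U, mink (Z - fderiv ℝ ψ p (ZT p)) (Wp p) = 1
  hWpOrient : ∀ p ∈ U, 0 < det4 (fderiv ℝ ψ p (ZT p)) (fderiv ℝ ψ p (Wc p))
    ((Real.sqrt 2)⁻¹ • ((Z - fderiv ℝ ψ p (ZT p)) + Wp p))
    ((Real.sqrt 2)⁻¹ • ((Z - fderiv ℝ ψ p (ZT p)) - Wp p))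

namespace CNND

variable (S : CNND)

/-- The normal part `Z^⊥` of `Z` along the surface. -/
def Zperp : Pt → E4 := fun p => S.Z - fderiv ℝ S.ψ p (S.ZT p)

/-- The second fundamental form of the surface. -/
def B : (Pt → Pt) → (Pt → Pt) → Pt → E4 := sff S.ψ S.conn

/-- The function `a = α(W) = ⟨B(W,W), Z^⊥⟩`. -/
def afun : Pt → ℝ := fun p => mink (S.B S.Wc S.Wc p) (S.Zperp p)

/-- The 1-form `α(X) = ⟨B(X,W), Z^⊥⟩`. -/
def alphaF (X : Pt → Pt) : Pt → ℝ := fun p => mink (S.B X S.Wc p) (S.Zperp p)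

/-- The mean curvature vector `H⃗ = (1/2)(B(Z^⊤,Z^⊤) + B(W,W))`. -/
def Hvec : Pt → E4 := fun p => (1 / 2 : ℝ) • (S.B S.ZT S.ZT p + S.B S.Wc S.Wc p)

/-- The Gauss curvature `K = ⟨R(Z^⊤,W)Z^⊤, W⟩`. -/
def Kfun : Pt → ℝ := fun p =>
  mink (fderiv ℝ S.ψ p (curvR S.conn S.ZT S.Wc S.ZT p)) (fderiv ℝ S.ψ p (S.Wc p))

/-- The normal curvature `K_N = ⟨R^⊥(Z^⊤,W)Z^⊥, W'⟩`. -/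
def KNfun : Pt → ℝ := fun p => mink (curvRperp S.nconn S.ZT S.Wc S.Zperp p) (S.Wp p)

end CNND

/-- The wedge `v ∧ w` of two vectors of `ℝ⁴`, as an antisymmetric matrix (bivector). -/
def wedge2 (v w : E4) : Fin 4 → Fin 4 → ℝ := fun i j => v i * w j - v j * w i

/-- The Gauss map `G = Z^⊤ ∧ W : M → Λ²ℝ^{3,1}`. -/
def CNND.Gmap (S : CNND) : Pt → Fin 4 → Fin 4 → ℝ :=
  fun p => wedge2 (fderiv ℝ S.ψ p (S.ZT p)) (fderiv ℝ S.ψ p (S.Wc p))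

/-- The signs of the Minkowski metric. -/
def epsM : Fin 4 → ℝ := fun i => if i = 3 then -1 else 1

/-- The induced (signature `(3,3)`) inner product on bivectors of `ℝ^{3,1}`:
`⟨v∧w, v'∧w'⟩ = ⟨v,v'⟩⟨w,w'⟩ − ⟨v,w'⟩⟨w,v'⟩`. -/
def binner (η η' : Fin 4 → Fin 4 → ℝ) : ℝ :=
  (1 / 2) * ∑ i : Fin 4, ∑ j : Fin 4, epsM i * epsM j * η i j * η' i j

/-- The wedge product `Λ²ℝ^{3,1} × Λ²ℝ^{3,1} → Λ⁴ℝ^{3,1} ≅ ℝ`, normalized so that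
`(v∧w)∧(v'∧w') = det(v,w,v',w')`. -/
def bwedge (η η' : Fin 4 → Fin 4 → ℝ) : ℝ :=
  (1 / 4) * ∑ σ : Equiv.Perm (Fin 4),
    ((Equiv.Perm.sign σ : ℤ) : ℝ) * η (σ 0) (σ 1) * η' (σ 2) (σ 3)

/-- The `ℂ`-bilinear form `H(η,η') = ⟨η,η'⟩ + i η∧η'` on bivectors, where `i = −⋆`. -/
def HformC (η η' : Fin 4 → Fin 4 → ℝ) : ℂ :=
  (binner η η' : ℝ) + (bwedge η η' : ℝ) * Complex.I

/-- The quadratic form `δ(u) = dG(u) ∧ dG(u)` whose zero directions are the asymptotic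
directions. -/
def CNND.deltaQ (S : CNND) (p : Pt) (u : Pt) : ℝ :=
  bwedge (fderiv ℝ S.Gmap p u) (fderiv ℝ S.Gmap p u)

theorem mink_add_left (u v w : E4) : mink (u + v) w = mink u w + mink v w := by
  simp only [mink, Pi.add_apply]; ring

theorem mink_sub_left (u v w : E4) : mink (u - v) w = mink u w - mink v w := by
  simp only [mink, Pi.sub_apply]; ring

theorem mink_neg_left (u v : E4) : mink (-u) v = -mink u v := by
  simp only [mink, Pi.neg_apply]; ring

theorem mink_comm (u v : E4) : mink u v = mink v u := by
  simp only [mink]; ring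

/-- Product rule for the Minkowski form along fields whose product is locally constant. -/
theorem mink_fderiv_add_eq_zero {f g : Pt → E4} {p : Pt} {c : ℝ}
    (hf : DifferentiableAt ℝ f p) (hg : DifferentiableAt ℝ g p)
    (h : ∀ᶠ q in nhds p, mink (f q) (g q) = c) (v : Pt) :
    mink (fderiv ℝ f p v) (g p) + mink (f p) (fderiv ℝ g p v) = 0 := by
  have hf' := hasFDerivAt_pi'.1 hf.hasFDerivAt
  have hg' := hasFDerivAt_pi'.1 hg.hasFDerivAt
  have hd := ((((hf' 0).mul (hg' 0)).add ((hf' 1).mul (hg' 1))).add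
    ((hf' 2).mul (hg' 2))).sub ((hf' 3).mul (hg' 3))
  have hc : HasFDerivAt (fun q => mink (f q) (g q)) (0 : Pt →L[ℝ] ℝ) p :=
    (hasFDerivAt_const c p).congr_of_eventuallyEq h
  have he := congrArg (fun L : Pt →L[ℝ] ℝ => L v) (hd.unique hc)
  simp at he
  simp only [mink]
  linarith

namespace CNND

variable (S : CNND) {p : Pt}

theorem contDiffAt_ψ (hp : p ∈ S.U) : ContDiffAt ℝ 2 S.ψ p :=
  (S.hψ.contDiffAt (S.hUopen.mem_nhds hp)).of_le
    (WithTop.coe_le_coe.2 (le_top : (2 : ℕ∞) ≤ ⊤))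

theorem differentiableAt_fderiv_ψ (hp : p ∈ S.U) : DifferentiableAt ℝ (fderiv ℝ S.ψ) p :=
  ((S.contDiffAt_ψ hp).fderiv_right (m := 1) one_add_one_eq_two.le).differentiableAt
    one_ne_zero

theorem differentiableAt_ZT (hp : p ∈ S.U) : DifferentiableAt ℝ S.ZT p :=
  (S.hZTsmooth.contDiffAt (S.hUopen.mem_nhds hp)).differentiableAt (by simp)

theorem differentiableAt_vecF {Y : Pt → Pt} (hp : p ∈ S.U) (hY : DifferentiableAt ℝ Y p) :
    DifferentiableAt ℝ (vecF S.ψ Y) p :=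
  (S.differentiableAt_fderiv_ψ hp).clm_apply hY

theorem fderiv_vecF {Y : Pt → Pt} (hp : p ∈ S.U) (hY : DifferentiableAt ℝ Y p) (v : Pt) :
    fderiv ℝ (vecF S.ψ Y) p v =
      fderiv ℝ S.ψ p (fderiv ℝ Y p v) + fderiv ℝ (fderiv ℝ S.ψ) p v (Y p) := by
  have h := ((S.differentiableAt_fderiv_ψ hp).hasFDerivAt.clm_apply hY.hasFDerivAt).fderiv
  exact (congrArg (fun L : Pt →L[ℝ] E4 => L v) h).trans (by simp)

theorem fderiv_fderiv_ψ_comm (hp : p ∈ S.U) (v w : Pt) :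
    fderiv ℝ (fderiv ℝ S.ψ) p v w = fderiv ℝ (fderiv ℝ S.ψ) p w v :=
  ((S.contDiffAt_ψ hp).isSymmSndFDerivAt (by simp)) v w

theorem mink_tangent_Zperp (hp : p ∈ S.U) (w : Pt) :
    mink (fderiv ℝ S.ψ p w) (S.Zperp p) = 0 :=
  (mink_comm _ _).trans (S.hZTtangentpart p hp w)

theorem eq_zero_of_mink_self {v : Pt} (hp : p ∈ S.U)
    (h : mink (fderiv ℝ S.ψ p v) (fderiv ℝ S.ψ p v) = 0) : v = 0 := by
  by_contra hv
  exact (S.hspacelike p hp v hv).ne' h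

theorem differentiableAt_Zperp (hp : p ∈ S.U) : DifferentiableAt ℝ S.Zperp p :=
  (S.differentiableAt_vecF hp (S.differentiableAt_ZT hp)).const_sub S.Z

theorem fderiv_Zperp (v : Pt) : fderiv ℝ S.Zperp p v = -fderiv ℝ (vecF S.ψ S.ZT) p v := by
  have h : fderiv ℝ S.Zperp p = -fderiv ℝ (vecF S.ψ S.ZT) p :=
    fderiv_const_sub (f := vecF S.ψ S.ZT) S.Z
  rw [h]; rfl

theorem mink_fderiv_vecF_ZT_Zperp (hp : p ∈ S.U) (v : Pt) :
    mink (fderiv ℝ (vecF S.ψ S.ZT) p v) (S.Zperp p) = 0 := by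
  have h := mink_fderiv_add_eq_zero (S.differentiableAt_Zperp hp) (S.differentiableAt_Zperp hp)
    (Filter.eventually_of_mem (S.hUopen.mem_nhds hp) S.hZperpNull) v
  rw [mink_comm (S.Zperp p), S.fderiv_Zperp, mink_neg_left] at h
  linarith

theorem mink_hessian_ZT_Zperp (hp : p ∈ S.U) (v : Pt) :
    mink (fderiv ℝ (fderiv ℝ S.ψ) p (S.ZT p) v) (S.Zperp p) = 0 := by
  have h := S.mink_fderiv_vecF_ZT_Zperp hp v
  rwa [S.fderiv_vecF hp (S.differentiableAt_ZT hp), mink_add_left, S.mink_tangent_Zperp hp,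
    zero_add, S.fderiv_fderiv_ψ_comm hp] at h

theorem mink_fderiv_vecF_const_Zperp (hp : p ∈ S.U) (w : Pt) :
    mink (fderiv ℝ (vecF S.ψ fun _ => w) p (S.ZT p)) (S.Zperp p) = 0 := by
  rw [S.fderiv_vecF hp (differentiableAt_const w), mink_add_left, S.mink_tangent_Zperp hp,
    S.mink_hessian_ZT_Zperp hp, add_zero]

theorem mink_B_Zperp (hp : p ∈ S.U) (X Y : Pt → Pt) :
    mink (S.B X Y p) (S.Zperp p) = mink (fderiv ℝ (vecF S.ψ Y) p (X p)) (S.Zperp p) := by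
  have h := S.mink_tangent_Zperp hp (S.conn X Y p)
  simp only [B, sff, Dflat, vecF, mink_sub_left] at h ⊢
  rw [h, sub_zero]

theorem shA_ZT_eq_zero (hp : p ∈ S.U) : S.shA S.ZT p = 0 := by
  apply S.eq_zero_of_mink_self hp
  have h := S.hshA S.ZT (fun _ => S.shA S.ZT p) p hp
    (S.differentiableAt_vecF hp (differentiableAt_const _))
  exact h.trans ((S.mink_B_Zperp hp _ _).trans (S.mink_fderiv_vecF_const_Zperp hp _))

theorem conn_ZT_ZT_eq_zero (hp : p ∈ S.U) : S.conn S.ZT S.ZT p = 0 := by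
  apply S.eq_zero_of_mink_self hp
  set w := S.conn S.ZT S.ZT p
  have hn : mink (fderiv ℝ (vecF S.ψ S.ZT) p (S.ZT p) - fderiv ℝ S.ψ p w)
      (fderiv ℝ S.ψ p w) = 0 :=
    S.hconn S.ZT S.ZT p hp (S.differentiableAt_vecF hp (S.differentiableAt_ZT hp)) w
  have ho := mink_fderiv_add_eq_zero (S.differentiableAt_Zperp hp)
    (S.differentiableAt_vecF hp (differentiableAt_const w))
    (Filter.eventually_of_mem (S.hUopen.mem_nhds hp) fun q hq => S.hZTtangentpart q hq w)
    (S.ZT p)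
  rw [mink_comm (S.Zperp p), S.mink_fderiv_vecF_const_Zperp hp, S.fderiv_Zperp,
    mink_neg_left] at ho
  rw [mink_sub_left] at hn
  simp only [vecF] at ho hn
  linarith

end CNND

/-- Let `M` be a spacelike surface in `ℝ^{3,1}` with a canonical normal null
direction `Z`.  Then `A_{Z^⊥}(Z^⊤) = 0` and `∇_{Z^⊤} Z^⊤ = 0`; in particular
`⟨B(X, Z^⊤), Z^⊥⟩ = 0` for every tangent vector field `X` on `M`. -/
theorem cnnd_shape_operator_kills_ZT (S : CNND) :
    ∀ p ∈ S.U,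
      S.shA S.ZT p = 0 ∧
      S.conn S.ZT S.ZT p = 0 ∧
      ∀ X : Pt → Pt, mink (S.B X S.ZT p) (S.Zperp p) = 0 := by
  intro p hp
  exact ⟨S.shA_ZT_eq_zero hp, S.conn_ZT_ZT_eq_zero hp, fun X =>
    (S.mink_B_Zperp hp X S.ZT).trans (S.mink_fderiv_vecF_ZT_Zperp hp (X p))⟩

end
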